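/- Let B=(1,b_2,...,b_k) with 1<b_2<...<b_k positive integers (k≥2), let c = max{O_B(r) : 0 ≤ r ≤ b_k−1} with c ≥ 2, and set u = max{c−1, ⌈(c−1)b_{k−1}/(b_k−b_{k−1})⌉}. Let h,d be positive integers with h ≥ ⌈d/(u+c−1)⌉. Then there exist nondecreasing sequences of nonnegative integers W_B=(w_0,...,w_{b_k−1}) and R_B=(r_0,...,r_{b_k−1}) with w_{b_k−1} − w_0 ≤ 1, such that for every positive integer a with gcd(a,d)=1 and a ≥ (u+c−1)b_k, writing j = a mod b_k and A(a) = (a, ha+d, ha+d b_2, ..., ha+d b_k), the Frobenius number satisfies g(A(a)) = (w_j h − 1)a + r_j d + (ha + b_k d)(⌊a/b_k⌋ − u − c + 1). -/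

import Mathlib

/-- `OB k b M` is the minimum of `x 1 + ⋯ + x k` over all nonnegative integer
solutions of `x 1 * b 1 + ⋯ + x k * b k = M`. -/
noncomputable def OB (k : ℕ) (b : ℕ → ℕ) (M : ℕ) : ℕ :=
  sInf {n : ℕ | ∃ x : ℕ → ℕ,
    (∑ i ∈ Finset.Icc 1 k, x i * b i) = M ∧ (∑ i ∈ Finset.Icc 1 k, x i) = n}

section OrderOfRepresentation

variable {k : ℕ} {b : ℕ → ℕ}

lemma OB_le (x : ℕ → ℕ) {M : ℕ} (hx : ∑ i ∈ Finset.Icc 1 k, x i * b i = M) :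
    OB k b M ≤ ∑ i ∈ Finset.Icc 1 k, x i :=
  Nat.sInf_le ⟨x, hx, rfl⟩

lemma exists_OB_eq (hk : 1 ≤ k) (hb1 : b 1 = 1) (M : ℕ) :
    ∃ x : ℕ → ℕ, ∑ i ∈ Finset.Icc 1 k, x i * b i = M ∧
      ∑ i ∈ Finset.Icc 1 k, x i = OB k b M := by
  refine Nat.sInf_mem (s := {n : ℕ | ∃ x : ℕ → ℕ,
    (∑ i ∈ Finset.Icc 1 k, x i * b i) = M ∧ (∑ i ∈ Finset.Icc 1 k, x i) = n})
    ⟨_, fun i => if i = 1 then M else 0, ?_, rfl⟩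
  simp [ite_mul, Finset.sum_ite_eq', hb1, hk]

lemma OB_zero : OB k b 0 = 0 :=
  Nat.le_zero.mp <| by simpa using OB_le (k := k) (b := b) (fun _ => 0) (M := 0) (by simp)

lemma OB_add_le (hk : 1 ≤ k) (hb1 : b 1 = 1) (M t : ℕ) :
    OB k b (M + t * b k) ≤ OB k b M + t := by
  obtain ⟨x, hx, hs⟩ := exists_OB_eq hk hb1 M
  refine (OB_le (fun i => x i + if i = k then t else 0) ?_).trans ?_
  · simp [add_mul, Finset.sum_add_distrib, hx, hk]
  · simp [Finset.sum_add_distrib, hs, hk]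

lemma OB_mul_le (hk : 1 ≤ k) (hb1 : b 1 = 1) (t : ℕ) : OB k b (t * b k) ≤ t := by
  simpa [OB_zero] using OB_add_le hk hb1 0 t

lemma le_of_forall_lt_succ (hmono : ∀ i, 1 ≤ i → i < k → b i < b (i + 1)) {i j : ℕ}
    (hi : 1 ≤ i) (hij : i ≤ j) (hj : j ≤ k) : b i ≤ b j := by
  induction j, hij using Nat.le_induction with
  | base => rfl
  | succ j hij ih => exact (ih (by lia)).trans (hmono j (by lia) (by lia)).le

lemma le_mul_OB (hk : 1 ≤ k) (hb1 : b 1 = 1)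
    (hmono : ∀ i, 1 ≤ i → i < k → b i < b (i + 1)) (M : ℕ) : M ≤ OB k b M * b k := by
  obtain ⟨x, hx, hs⟩ := exists_OB_eq hk hb1 M
  rw [← hs, Finset.sum_mul]
  conv_lhs => rw [← hx]
  refine Finset.sum_le_sum fun i hi => ?_
  rw [Finset.mem_Icc] at hi
  exact Nat.mul_le_mul_left _ (le_of_forall_lt_succ hmono hi.1 hi.2 le_rfl)

lemma OB_le_div_add (hk : 1 ≤ k) (hb1 : b 1 = 1) (hbk : 0 < b k) {c : ℕ}
    (hc : ∀ r < b k, OB k b r ≤ c) (M : ℕ) : OB k b M ≤ M / b k + c := by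
  have h1 := OB_add_le hk hb1 (M % b k) (M / b k)
  rw [Nat.mod_add_div'] at h1
  have h2 := hc _ (Nat.mod_lt M hbk)
  lia

/-- Beyond `u * b k`, some optimal representation uses the largest part `b k`. -/
lemma OB_add_eq_succ (hk : 2 ≤ k) (hb1 : b 1 = 1)
    (hmono : ∀ i, 1 ≤ i → i < k → b i < b (i + 1)) {c u : ℕ}
    (hc : ∀ r < b k, OB k b r ≤ c) (hc1 : 1 ≤ c)
    (hu : (c - 1) * b (k - 1) ≤ u * (b k - b (k - 1))) {M : ℕ} (hM : u * b k ≤ M) :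
    OB k b (M + b k) = OB k b M + 1 := by
  have hlt : b (k - 1) < b k := by
    have := hmono (k - 1) (by lia) (by lia)
    rwa [Nat.sub_add_cancel (by lia)] at this
  refine le_antisymm (by simpa using OB_add_le (k := k) (by lia) hb1 M 1) ?_
  obtain ⟨x, hx, hs⟩ := exists_OB_eq (k := k) (by lia) hb1 (M + b k)
  have hmem : k ∈ Finset.Icc 1 k := by simp; lia
  rcases Nat.eq_zero_or_pos (x k) with h0 | hpos
  · have h1 : M + b k ≤ OB k b (M + b k) * b (k - 1) := by
      rw [← hs, Finset.sum_mul]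
      conv_lhs => rw [← hx]
      refine Finset.sum_le_sum fun i hi => ?_
      rw [Finset.mem_Icc] at hi
      rcases eq_or_ne i k with rfl | hik
      · simp [h0]
      · exact Nat.mul_le_mul_left _ (le_of_forall_lt_succ hmono hi.1 (by lia) (by lia))
    have h2 := OB_le_div_add (by lia) hb1 (by lia) hc M
    have h3 := Nat.div_mul_le_self M (b k)
    have h4 : u ≤ M / b k := (Nat.le_div_iff_mul_le (by lia)).2 hM
    by_contra! hcon
    have h5 : OB k b (M + b k) ≤ M / b k + c := by lia
    generalize OB k b (M + b k) = n at *
    generalize M / b k = q at *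
    obtain ⟨e, he⟩ := Nat.exists_eq_add_of_lt hlt
    obtain ⟨c', rfl⟩ := Nat.exists_eq_add_of_le hc1
    have he' : b k - b (k - 1) = e + 1 := by lia
    rw [he'] at hu
    rw [he] at h1 h3
    simp only [Nat.add_sub_cancel_left] at hu
    nlinarith [Nat.mul_le_mul_right (b (k - 1)) h5, Nat.mul_le_mul_right (e + 1) h4]
  · have h1 : OB k b M ≤ ∑ i ∈ Finset.Icc 1 k, (x i - if i = k then 1 else 0) := by
      refine OB_le _ ?_
      rw [← Finset.add_sum_erase _ _ hmem] at hx ⊢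
      have : ∑ i ∈ (Finset.Icc 1 k).erase k, (x i - if i = k then 1 else 0) * b i =
          ∑ i ∈ (Finset.Icc 1 k).erase k, x i * b i :=
        Finset.sum_congr rfl fun i hi => by simp [Finset.ne_of_mem_erase hi]
      rw [this]
      obtain ⟨y, hy⟩ := Nat.exists_eq_add_of_le' hpos
      simp only [hy, if_true, Nat.add_sub_cancel] at hx ⊢
      linarith
    rw [← Finset.add_sum_erase _ _ hmem] at hs h1
    have : ∑ i ∈ (Finset.Icc 1 k).erase k, (x i - if i = k then 1 else 0) =
        ∑ i ∈ (Finset.Icc 1 k).erase k, x i :=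
      Finset.sum_congr rfl fun i hi => by simp [Finset.ne_of_mem_erase hi]
    rw [this] at h1
    simp only [if_true] at h1
    lia

end OrderOfRepresentation

section Window

variable {f : ℕ → ℕ} {n N : ℕ}

/-- The window `[L, L + n)` has a last maximizer of `f`. -/
lemma exists_last_argmax (f : ℕ → ℕ) (hn : 0 < n) (L : ℕ) :
    ∃ p, L ≤ p ∧ p < L + n ∧
      ∀ s, L ≤ s → s < L + n → f s < f p ∨ (f s = f p ∧ s ≤ p) := by
  obtain ⟨p, hp, hmax⟩ := Finset.exists_max_image (Finset.Ico L (L + n))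
    (fun s => toLex (f s, s)) ⟨L, by simp [hn]⟩
  rw [Finset.mem_Ico] at hp
  refine ⟨p, hp.1, hp.2, fun s h1 h2 => ?_⟩
  simpa [Prod.Lex.le_iff] using hmax s (Finset.mem_Ico.2 ⟨h1, h2⟩)

lemma apply_add_mul (hper : ∀ M, N ≤ M → f (M + n) = f M + 1) {M : ℕ} (hM : N ≤ M) (t : ℕ) :
    f (M + t * n) = f M + t := by
  induction t with
  | zero => simp
  | succ t ih =>
    rw [add_mul, one_mul, ← add_assoc, hper _ (by lia), ih, add_assoc]

lemma last_argmax_mono (hper : ∀ M, N ≤ M → f (M + n) = f M + 1) {p : ℕ → ℕ}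
    (hp : ∀ L, L ≤ p L ∧ p L < L + n ∧
      ∀ s, L ≤ s → s < L + n → f s < f (p L) ∨ (f s = f (p L) ∧ s ≤ p L))
    {L L' : ℕ} (hL : N ≤ L) (hLL : L ≤ L') : f (p L) ≤ f (p L') ∧ p L ≤ p L' := by
  induction L', hLL using Nat.le_induction with
  | base => simp
  | succ K hK ih =>
    suffices f (p K) ≤ f (p (K + 1)) ∧ p K ≤ p (K + 1) from
      ⟨ih.1.trans this.1, ih.2.trans this.2⟩
    obtain ⟨h1, h2, h3⟩ := hp K
    obtain ⟨h4, h5, h6⟩ := hp (K + 1)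
    have h7 := h3 (p (K + 1)) (by lia)
    rcases h1.eq_or_lt with h8 | h8
    · have h9 := h6 (K + n) (by lia) (by lia)
      have h10 := hper K (by lia)
      have h11 : f K = f (p K) := congrArg f h8
      lia
    · have h9 := h6 (p K) (by lia) (by lia)
      lia

end Window

/-- If `OB k b r * (h * a) + r * d` is maximal at `r = s` among `r < a`, the Frobenius number
is that maximum minus `a`. -/
lemma isGreatest_of_max {k : ℕ} {b : ℕ → ℕ} (hk : 1 ≤ k) (hb1 : b 1 = 1) {a d h s : ℕ}
    (ha : 0 < a) (hgcd : Nat.gcd a d = 1) (hs : s < a)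
    (hmax : ∀ r < a, OB k b r * (h * a) + r * d ≤ OB k b s * (h * a) + s * d)
    (hshift : ∀ M, a + s ≤ M → OB k b s ≤ OB k b M) :
    IsGreatest {n : ℤ | ¬ ∃ x0 : ℕ, ∃ x : ℕ → ℕ,
        n = ((x0 * a + ∑ i ∈ Finset.Icc 1 k, x i * (h * a + d * b i) : ℕ) : ℤ)}
      (((OB k b s * (h * a) + s * d : ℕ) : ℤ) - a) := by
  have hsum : ∀ x : ℕ → ℕ, ∑ i ∈ Finset.Icc 1 k, x i * (h * a + d * b i) =
      (∑ i ∈ Finset.Icc 1 k, x i) * (h * a) + (∑ i ∈ Finset.Icc 1 k, x i * b i) * d := by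
    intro x
    rw [Finset.sum_mul, Finset.sum_mul, ← Finset.sum_add_distrib]
    exact Finset.sum_congr rfl fun i _ => by ring
  have hcop : IsCoprime (a : ℤ) (d : ℤ) := Nat.isCoprime_iff_coprime.2 hgcd
  constructor
  · rintro ⟨x0, x, hx⟩
    rw [hsum] at hx
    have hle := OB_le (k := k) (b := b) x rfl
    generalize (∑ i ∈ Finset.Icc 1 k, x i * b i) = M at *
    generalize (∑ i ∈ Finset.Icc 1 k, x i) = S at *
    have hdvd : (a : ℤ) ∣ (M : ℤ) - s := by
      refine hcop.dvd_of_dvd_mul_right ⟨(OB k b s : ℤ) * h - 1 - x0 - S * h, ?_⟩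
      push_cast at hx
      linear_combination -hx
    have hcases : s ≤ M ∧ OB k b s ≤ OB k b M := by
      rcases lt_trichotomy M s with hM | rfl | hM
      · have := Int.le_of_dvd (by lia) (dvd_neg.2 hdvd)
        lia
      · simp
      · have := Int.le_of_dvd (by lia) hdvd
        exact ⟨hM.le, hshift M (by lia)⟩
    have h1 : OB k b s * (h * a) ≤ S * (h * a) := Nat.mul_le_mul_right _ (hcases.2.trans hle)
    have h2 : s * d ≤ M * d := Nat.mul_le_mul_right _ hcases.1
    have h3 : OB k b s * (h * a) + s * d = x0 * a + (S * (h * a) + M * d) + a := by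
      zify; push_cast at hx; linarith
    lia
  · intro n hn
    by_contra! hlt
    apply hn
    obtain ⟨v, y, hvy⟩ := hcop
    have hr0 := Int.emod_nonneg (n * y) (b := (a : ℤ)) (by lia)
    have hra := Int.emod_lt_of_pos (n * y) (b := (a : ℤ)) (by lia)
    have hrd := Int.emod_add_mul_ediv (n * y) (a : ℤ)
    lift (n * y) % (a : ℤ) to ℕ using hr0 with r hr
    obtain ⟨x, hx1, hx2⟩ := exists_OB_eq hk hb1 r
    have hm := hmax r (by lia)
    have hdvd : n - ((OB k b r * (h * a) + r * d : ℕ) : ℤ) =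
        a * (n * v + (n * y / a) * d - OB k b r * h) := by
      push_cast
      linear_combination (-n) * hvy - d * hrd
    generalize n * v + (n * y / a) * d - OB k b r * h = e at *
    have he : 0 ≤ e := by
      by_contra! he
      have : (a : ℤ) * e ≤ a * (-1) := mul_le_mul_of_nonneg_left (by lia) (by lia)
      lia
    lift e to ℕ using he
    refine ⟨e, x, ?_⟩
    rw [hsum, hx1, hx2]
    push_cast at hdvd ⊢
    linarith

/-- Every `r < a` is dominated, in position and in value, by one of the last `n` residues. -/
lemma exists_mem_last_window {f : ℕ → ℕ} {n u c a : ℕ} (hn : 0 < n) (hc : 2 ≤ c)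
    (hper : ∀ M, u * n ≤ M → f (M + n) = f M + 1)
    (hmul : ∀ t, f (t * n) ≤ t) (hup : ∀ M, f M ≤ M / n + c) (hlow : ∀ M, M ≤ f M * n)
    (ha : (u + c - 1) * n ≤ a) {r : ℕ} (hr : r < a) :
    ∃ s, r ≤ s ∧ s < a ∧ a ≤ s + n ∧ f r ≤ f s := by
  have h1 := Nat.div_add_mod (a - 1 - r) n
  have h2 := Nat.mod_lt (a - 1 - r) hn
  set m := (a - 1 - r) / n with hm
  have h3 : n * m = m * n := mul_comm _ _
  refine ⟨r + m * n, by lia, by lia, by lia, ?_⟩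
  rcases le_or_gt (u * n) r with hru | hru
  · rw [apply_add_mul hper hru]; lia
  · by_contra! hlt
    have h4 : r / n < u := Nat.div_lt_of_lt_mul (by rwa [mul_comm] at hru)
    have h5 := hup r
    have h6 : f (r + m * n) ≤ u + c - 2 := by lia
    have h7 := (hlow (r + m * n)).trans (Nat.mul_le_mul_right n h6)
    have h8 : (u + c - 1) * n = (u + c - 2) * n + n := by
      rw [show u + c - 1 = (u + c - 2) + 1 by lia, add_mul, one_mul]
    have h9 : r = (u + c - 2 - m) * n := by rw [Nat.sub_mul]; lia
    have h10 := hmul (u + c - 2 - m)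
    rw [← h9] at h10
    have h11 : u + c - 2 ≤ f (r + m * n) :=
      Nat.le_of_mul_le_mul_right ((by lia : _ ≤ r + m * n).trans (hlow _)) hn
    lia

theorem stmt_4 (k : ℕ) (b : ℕ → ℕ) (hk : 2 ≤ k) (hb1 : b 1 = 1)
    (hmono : ∀ i, 1 ≤ i → i < k → b i < b (i + 1))
    (c : ℕ) (hc : c = (Finset.range (b k)).sup fun r => OB k b r) (hc2 : 2 ≤ c)
    (u : ℕ) (hu : u = max (c - 1) (((c - 1) * b (k - 1)) ⌈/⌉ (b k - b (k - 1))))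
    (h d : ℕ) (hh : 0 < h) (hd : 0 < d) (hhd : d ⌈/⌉ (u + c - 1) ≤ h) :
    ∃ w r : ℕ → ℕ,
      (∀ i j, i ≤ j → j < b k → w i ≤ w j) ∧
      (∀ i j, i ≤ j → j < b k → r i ≤ r j) ∧
      w (b k - 1) - w 0 ≤ 1 ∧
      ∀ a : ℕ, 0 < a → Nat.gcd a d = 1 → (u + c - 1) * b k ≤ a →
        IsGreatest {n : ℤ | ¬ ∃ x0 : ℕ, ∃ x : ℕ → ℕ,
            n = ((x0 * a + ∑ i ∈ Finset.Icc 1 k, x i * (h * a + d * b i) : ℕ) : ℤ)}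
          (((w (a % b k) : ℤ) * h - 1) * a + (r (a % b k) : ℤ) * d
            + ((h : ℤ) * a + (b k : ℤ) * d) * (((a / b k : ℕ) : ℤ) - u - c + 1)) := by
  have hlt : b (k - 1) < b k := by
    have := hmono (k - 1) (by lia) (by lia)
    rwa [Nat.sub_add_cancel (by lia)] at this
  have hn : 0 < b k := by lia
  have hk1 : 1 ≤ k := by lia
  have hcle : ∀ r < b k, OB k b r ≤ c := fun r hr => by
    rw [hc]
    exact Finset.le_sup (f := fun r => OB k b r) (Finset.mem_range.2 hr)
  have hu1 : c - 1 ≤ u := hu ▸ le_max_left _ _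
  have hu2 : (c - 1) * b (k - 1) ≤ u * (b k - b (k - 1)) := by
    rw [mul_comm u]
    exact (ceilDiv_le_iff_le_mul (by lia)).1 (hu ▸ le_max_right _ _)
  have hdh : d ≤ (u + c - 1) * h := (ceilDiv_le_iff_le_mul (by lia)).1 hhd
  have hper : ∀ M, u * b k ≤ M → OB k b (M + b k) = OB k b M + 1 := fun M hM =>
    OB_add_eq_succ hk hb1 hmono hcle (by lia) hu2 hM
  have hup := OB_le_div_add hk1 hb1 hn hcle
  have hlow := le_mul_OB hk1 hb1 hmono
  choose p hp using exists_last_argmax (OB k b) hn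
  set L := (u + c - 2) * b k
  have hL : u * b k ≤ L := Nat.mul_le_mul_right _ (by lia)
  refine ⟨fun j => OB k b (p (L + j)), fun j => p (L + j),
    fun i j hij _ => (last_argmax_mono hper hp (by lia) (by lia)).1,
    fun i j hij _ => (last_argmax_mono hper hp (by lia) (by lia)).2, ?_, ?_⟩
  · obtain ⟨h1, h2, -⟩ := hp (L + (b k - 1))
    obtain ⟨-, -, h3⟩ := hp (L + 0)
    have h4 := h3 (p (L + (b k - 1)))
    have h5 := h3 (p (L + (b k - 1)) - b k)
    have h6 := hper (p (L + (b k - 1)) - b k)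
    rcases lt_or_ge (p (L + (b k - 1))) (L + b k) with h7 | h7
    · lia
    · rw [Nat.sub_add_cancel (by lia)] at h6
      lia
  · intro a ha hgcd haL
    obtain ⟨h1, h2, h3⟩ := hp (L + a % b k)
    have hq := Nat.div_add_mod' a (b k)
    have hqle : u + c - 1 ≤ a / b k := (Nat.le_div_iff_mul_le hn).2 haL
    obtain ⟨t, ht⟩ := Nat.exists_eq_add_of_le hqle
    have hLsucc : (u + c - 1) * b k = L + b k := by
      rw [show u + c - 1 = (u + c - 2) + 1 by lia, add_mul, one_mul]
    have haeq : a = L + b k + t * b k + a % b k := by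
      rw [← hLsucc, ← add_mul, ← ht, hq]
    set j := a % b k
    set P := p (L + j)
    have hfs : OB k b (P + t * b k) = OB k b P + t := apply_add_mul hper (by lia) t
    have hha : d * b k ≤ h * a := calc
      d * b k ≤ (u + c - 1) * h * b k := Nat.mul_le_mul_right _ hdh
      _ = h * ((u + c - 1) * b k) := by ring
      _ ≤ h * a := Nat.mul_le_mul_left _ haL
    have key := isGreatest_of_max (k := k) (b := b) (h := h) (s := P + t * b k) hk1 hb1 ha hgcd
      (by lia) ?_ ?_
    · convert key using 1
      rw [hfs, ht]
      push_cast [show 1 ≤ u + c by lia]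
      ring
    · intro r hr
      obtain ⟨s, hrs, hsa, has, hfrs⟩ := exists_mem_last_window hn hc2 hper
        (OB_mul_le hk1 hb1) hup hlow haL hr
      obtain ⟨v, rfl⟩ := Nat.exists_eq_add_of_le' (show t * b k ≤ s by lia)
      refine (Nat.add_le_add (Nat.mul_le_mul_right _ hfrs) (Nat.mul_le_mul_right d hrs)).trans ?_
      rw [hfs, apply_add_mul hper (by lia) t]
      rcases h3 v (by lia) (by lia) with h4 | ⟨h4, h5⟩
      · have h6 : v ≤ P + b k := by lia
        have h7 := Nat.mul_le_mul_right (h * a) (Nat.succ_le_of_lt h4)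
        have h8 := Nat.mul_le_mul_right d h6
        rw [Nat.succ_mul] at h7
        rw [add_mul, mul_comm (b k)] at h8
        simp only [add_mul]
        lia
      · rw [h4]
        gcongr
    · intro M hM
      have h4 := hup (P + t * b k)
      have h5 := Nat.div_mul_le_self (P + t * b k) (b k)
      have h6 : u + c - 1 + (P + t * b k) / b k ≤ OB k b M := by
        refine Nat.le_of_mul_le_mul_right ?_ hn
        rw [add_mul]
        exact (by lia : _ ≤ M).trans (hlow M)
      lia
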